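/- Let d ≥ 1 be an integer. There exist constants 0 < c_1 ≤ c_2, depending only on d, such that for every function Φ : ℕ → [2, ∞) and every integer n ≥ 1, the Lebesgue measure of the set { x ∈ [0,1) irrational : a_1(x) · a_{n+1}(x) · a_{2n+1}(x) ⋯ a_{(d−1)n+1}(x) ≥ Φ(n) } lies between c_1 · (log Φ(n))^{d−1}/Φ(n) and c_2 · (log Φ(n))^{d−1}/Φ(n). -/

import Mathlib

open MeasureTheory Filter Set

/-- The Gauss map `T(x) = 1/x - ⌊1/x⌋` (with `T(0) = 0`). -/
noncomputable def gaussMap (x : ℝ) : ℝ := if x = 0 then 0 else 1 / x - (⌊1 / x⌋ : ℝ)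

/-- The `n`-th partial quotient `a_n(x) = ⌊1 / T^{n-1}(x)⌋` (for `n ≥ 1`). -/
noncomputable def pq (n : ℕ) (x : ℝ) : ℕ := ⌊1 / (gaussMap^[n - 1] x)⌋₊

/-- `Λ_d(Φ)`: irrational `x ∈ [0,1)` with `a_n(x) a_{2n}(x) ⋯ a_{dn}(x) ≥ Φ(n)`
for infinitely many `n`. -/
def Lambda (d : ℕ) (Φ : ℕ → ℝ) : Set ℝ :=
  {x | x ∈ Set.Ico (0 : ℝ) 1 ∧ Irrational x ∧
    ∃ᶠ n in Filter.atTop, Φ n ≤ ∏ i ∈ Finset.Icc 1 d, (pq (i * n) x : ℝ)}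

noncomputable def JJ (t : ℝ) (G : ℝ → ENNReal) : ENNReal :=
  ∫⁻ x in Ioo (0:ℝ) 1, ENNReal.ofReal ((1 + t) / (1 + t * x) ^ 2) * G x

noncomputable def pp (t : ℝ) (j : ℕ) : ℝ := (1 + t) / ((j + 1 + t) * (j + 2 + t))

lemma pp_nonneg {t : ℝ} (ht : 0 ≤ t) (j : ℕ) : 0 ≤ pp t j := by
  unfold pp; positivity

lemma JJ_mono {t : ℝ} {G H : ℝ → ENNReal} (h : ∀ x ∈ Ioo (0:ℝ) 1, G x ≤ H x) : JJ t G ≤ JJ t H := by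
  unfold JJ
  refine setLIntegral_mono' measurableSet_Ioo fun x hx => ?_
  gcongr
  exact h x hx

lemma JJ_congr {t : ℝ} {G H : ℝ → ENNReal} (h : ∀ x ∈ Ioo (0:ℝ) 1, G x = H x) : JJ t G = JJ t H :=
  le_antisymm (JJ_mono fun x hx => (h x hx).le) (JJ_mono fun x hx => (h x hx).ge)

lemma Ioc_decomp : Ioc (0:ℝ) 1 = ⋃ j : ℕ, (fun y : ℝ => 1 / ((j:ℝ) + 1 + y)) '' Ico 0 1 := by
  ext x
  simp only [mem_iUnion, mem_image, mem_Ioc, mem_Ico]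
  constructor
  · rintro ⟨h0, h1⟩
    have h2 : 1 ≤ 1 / x := by rw [le_div_iff₀ h0]; linarith
    have hf : 1 ≤ ⌊1 / x⌋₊ := Nat.le_floor (by simpa using h2)
    have hfl := Nat.floor_le (by linarith : 0 ≤ 1 / x)
    have hfu := Nat.lt_floor_add_one (1 / x)
    refine ⟨⌊1 / x⌋₊ - 1, 1 / x - ⌊1 / x⌋₊, ⟨by linarith, by linarith⟩, ?_⟩
    rw [Nat.cast_sub hf]
    have : ((⌊1 / x⌋₊:ℝ) - ((1:ℕ):ℝ) + 1 + (1 / x - ⌊1 / x⌋₊)) = 1 / x := by push_cast; ring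
    rw [this]; simp
  · rintro ⟨j, y, ⟨h0, h1⟩, rfl⟩
    have hj : (0:ℝ) ≤ j := j.cast_nonneg
    refine ⟨by positivity, ?_⟩
    rw [div_le_one (by positivity)]; linarith

lemma inj_br (j : ℕ) : InjOn (fun y : ℝ => 1 / ((j:ℝ) + 1 + y)) (Ico 0 1) := by
  intro a ha b hb h
  simp only [one_div, inv_inj] at h
  linarith

lemma floor_br (j : ℕ) {y : ℝ} (h0 : 0 ≤ y) (h1 : y < 1) : ⌊(j:ℝ) + 1 + y⌋₊ = j + 1 := by
  rw [Nat.floor_eq_iff (by positivity)]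
  push_cast; constructor <;> linarith

lemma JJ_rec {t : ℝ} (ht : 0 ≤ t) (G : ℝ → ENNReal) :
    JJ t G = ∑' j : ℕ, ENNReal.ofReal (pp t j) *
      JJ (1 / (j + 1 + t)) (fun y => G (1 / (j + 1 + y))) := by
  unfold JJ
  rw [setLIntegral_congr (Ioo_ae_eq_Ioc (μ := volume) (a := (0:ℝ)) (b := 1)), Ioc_decomp,
    lintegral_iUnion]
  · congr 1
    ext j
    have hj : (0:ℝ) ≤ j := j.cast_nonneg
    rw [lintegral_image_eq_lintegral_abs_deriv_mul measurableSet_Ico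
      (f' := fun y : ℝ => - 1 / ((j:ℝ) + 1 + y) ^ 2) _ (inj_br j),
      ← lintegral_const_mul' _ _ ENNReal.ofReal_ne_top,
      setLIntegral_congr (Ioo_ae_eq_Ico (μ := volume) (a := (0:ℝ)) (b := 1)).symm]
    · refine setLIntegral_congr_fun measurableSet_Ioo fun y hy => ?_
      have hy0 : 0 < y := hy.1
      simp only []
      rw [← mul_assoc, ← mul_assoc, ← ENNReal.ofReal_mul (abs_nonneg _),
        ← ENNReal.ofReal_mul (pp_nonneg ht j)]
      congr 2
      rw [neg_div, abs_neg, abs_of_nonneg (by positivity)]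
      unfold pp
      have : (j:ℝ) + 1 + t + y ≠ 0 := by positivity
      have : (j:ℝ) + 1 + y + t ≠ 0 := by positivity
      have e1 : 1 + t * (1 / ((j:ℝ) + 1 + y)) = (j + 1 + t + y) / (j + 1 + y) := by
        field_simp; ring
      have e2 : 1 + 1 / ((j:ℝ) + 1 + t) * y = (j + 1 + t + y) / (j + 1 + t) := by
        field_simp
      have e3 : 1 + 1 / ((j:ℝ) + 1 + t) = (j + 2 + t) / (j + 1 + t) := by
        field_simp; ring
      rw [e1, e2, e3]
      field_simp
    · intro y hy
      have hy0 : 0 ≤ y := hy.1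
      have h := ((hasDerivAt_id y).const_add ((j:ℝ) + 1)).inv (by simp; positivity)
      simpa [Pi.inv_def] using h.hasDerivWithinAt
  · intro j
    have hj : (0:ℝ) ≤ j := j.cast_nonneg
    refine measurableSet_Ico.image_of_continuousOn_injOn ?_ (inj_br j)
    refine ContinuousOn.div continuousOn_const (by fun_prop) fun y hy => ?_
    have hy0 : 0 ≤ y := hy.1
    positivity
  · intro i j hij
    rw [Function.onFun, Set.disjoint_left]
    rintro _ ⟨y, hy, rfl⟩ ⟨z, hz, h⟩
    simp only [one_div, inv_inj] at h
    apply hij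
    have h1 := floor_br i hy.1 hy.2
    rw [← h, floor_br j hz.1 hz.2] at h1
    omega

lemma hasSum_pp {t : ℝ} (ht : 0 ≤ t) (N : ℕ) :
    HasSum (fun j => pp t (j + N)) ((1 + t) / (N + 1 + t)) := by
  rw [hasSum_iff_tendsto_nat_of_nonneg (fun j => pp_nonneg ht _)]
  have h : ∀ M : ℕ, ∑ i ∈ Finset.range M, pp t (i + N)
      = (1 + t) / (N + 1 + t) - (1 + t) / (M + (N + 1 + t)) := by
    intro M
    induction M with
    | zero => simp
    | succ M ih =>
      rw [Finset.sum_range_succ, ih]; unfold pp; push_cast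
      field_simp
      ring
  simp_rw [h]
  have : Tendsto (fun M : ℕ => (1 + t) / ((M:ℝ) + (N + 1 + t))) atTop (nhds 0) :=
    Tendsto.div_atTop tendsto_const_nhds
      (tendsto_atTop_add_const_right _ _ tendsto_natCast_atTop_atTop)
  simpa using tendsto_const_nhds.sub this

lemma tsum_pp {t : ℝ} (ht : 0 ≤ t) (N : ℕ) :
    ∑' j, ENNReal.ofReal (pp t (j + N)) = ENNReal.ofReal ((1 + t) / (N + 1 + t)) := by
  rw [← ENNReal.ofReal_tsum_of_nonneg (fun j => pp_nonneg ht _) (hasSum_pp ht N).summable,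
    (hasSum_pp ht N).tsum_eq]

lemma tsum_pp_zero {t : ℝ} (ht : 0 ≤ t) :
    ∑' j, ENNReal.ofReal (pp t j) = 1 := by
  have := tsum_pp ht 0
  simp only [add_zero, Nat.cast_zero, zero_add] at this
  rw [this, div_self (by positivity)]; simp

lemma JJ_one {t : ℝ} (ht : 0 ≤ t) : JJ t (fun _ => 1) = 1 := by
  have himg : (fun x : ℝ => (1 + t) * x / (1 + t * x)) '' Ioo 0 1 = Ioo 0 1 := by
    ext y
    simp only [mem_image, mem_Ioo]
    constructor
    · rintro ⟨x, ⟨h0, h1⟩, rfl⟩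
      refine ⟨by positivity, ?_⟩
      rw [div_lt_one (by positivity)]; linarith
    · rintro ⟨h0, h1⟩
      have hp : 0 < 1 + t - t * y := by nlinarith
      refine ⟨y / (1 + t - t * y), ⟨by positivity, ?_⟩, ?_⟩
      · rw [div_lt_one hp]; nlinarith
      · have : 1 + t * (y / (1 + t - t * y)) = (1 + t) / (1 + t - t * y) := by
          field_simp; ring
        rw [this]; field_simp
  have hinj : InjOn (fun x : ℝ => (1 + t) * x / (1 + t * x)) (Ioo 0 1) := by
    intro a ha b hb h
    have ha0 : 0 < a := ha.1
    have hb0 : 0 < b := hb.1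
    simp only [] at h
    rw [div_eq_div_iff (by positivity) (by positivity)] at h
    have : (1 + t) * (a - b) = 0 := by linarith
    rcases mul_eq_zero.1 this with h | h <;> linarith
  have := lintegral_image_eq_lintegral_abs_deriv_mul measurableSet_Ioo
      (f' := fun x : ℝ => (1 + t) / (1 + t * x) ^ 2) (f := fun x : ℝ => (1 + t) * x / (1 + t * x))
      (s := Ioo 0 1) ?_ hinj (fun _ => 1)
  · rw [himg] at this
    simp only [lintegral_const, MeasurableSet.univ, Measure.restrict_apply, univ_inter,
      Real.volume_Ioo, sub_zero, ENNReal.ofReal_one, mul_one] at this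
    unfold JJ
    refine Eq.trans ?_ this.symm
    refine setLIntegral_congr_fun measurableSet_Ioo fun y hy => ?_
    simp only [mul_one]
    rw [abs_of_nonneg (by positivity)]
  · intro x hx
    have hx0 : 0 < x := hx.1
    have h1 : HasDerivAt (fun x : ℝ => (1 + t) * x) (1 + t) x := by
      simpa using (hasDerivAt_id x).const_mul (1 + t)
    have h2 : HasDerivAt (fun x : ℝ => 1 + t * x) t x := by
      simpa using ((hasDerivAt_id x).const_mul t).const_add 1
    have h : HasDerivAt (fun x : ℝ => (1 + t) * x / (1 + t * x))
        (((1 + t) * (1 + t * x) - (1 + t) * x * t) / (1 + t * x) ^ 2) x :=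
      h1.div h2 (by positivity)
    have e : ((1 + t) * (1 + t * x) - (1 + t) * x * t) = 1 + t := by ring
    rw [e] at h
    exact h.hasDerivWithinAt

lemma gm_br (j : ℕ) {y : ℝ} (h0 : 0 < y) (h1 : y < 1) : gaussMap (1 / ((j:ℝ) + 1 + y)) = y := by
  have hj : (0:ℝ) < j + 1 + y := by positivity
  unfold gaussMap
  rw [if_neg (by positivity), one_div_one_div]
  have : ⌊(j:ℝ) + 1 + y⌋ = (j:ℤ) + 1 := by
    rw [Int.floor_eq_iff]; push_cast; constructor <;> linarith
  rw [this]; push_cast; ring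

lemma s_mem {t : ℝ} (ht : 0 ≤ t) (j : ℕ) : 0 ≤ 1 / ((j:ℝ) + 1 + t) ∧ 1 / ((j:ℝ) + 1 + t) ≤ 1 := by
  refine ⟨by positivity, ?_⟩
  have hj : (0:ℝ) ≤ j := j.cast_nonneg
  rw [div_le_one (by positivity)]; linarith

lemma JJ_iter_le {H : ℝ → ENNReal} {B : ENNReal} (hB : ∀ t : ℝ, 0 ≤ t → t ≤ 1 → JJ t H ≤ B) (m : ℕ) :
    ∀ t : ℝ, 0 ≤ t → t ≤ 1 → JJ t (fun x => H (gaussMap^[m] x)) ≤ B := by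
  induction m with
  | zero => simpa using hB
  | succ m ih =>
    intro t h0 h1
    rw [JJ_rec h0]
    calc _ ≤ ∑' j : ℕ, ENNReal.ofReal (pp t j) * B := by
          refine ENNReal.tsum_le_tsum fun j => ?_
          gcongr
          refine le_trans (le_of_eq ?_) (ih _ (s_mem h0 j).1 (s_mem h0 j).2)
          refine JJ_congr fun x hx => ?_
          rw [Function.iterate_succ_apply, gm_br j hx.1 hx.2]
      _ = B := by rw [ENNReal.tsum_mul_right, tsum_pp_zero h0, one_mul]

lemma le_JJ_iter {H : ℝ → ENNReal} {B : ENNReal} (hB : ∀ t : ℝ, 0 ≤ t → t ≤ 1 → B ≤ JJ t H) (m : ℕ) :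
    ∀ t : ℝ, 0 ≤ t → t ≤ 1 → B ≤ JJ t (fun x => H (gaussMap^[m] x)) := by
  induction m with
  | zero => simpa using hB
  | succ m ih =>
    intro t h0 h1
    rw [JJ_rec h0]
    calc B = ∑' j : ℕ, ENNReal.ofReal (pp t j) * B := by
            rw [ENNReal.tsum_mul_right, tsum_pp_zero h0, one_mul]
      _ ≤ _ := by
          refine ENNReal.tsum_le_tsum fun j => ?_
          gcongr
          refine le_trans (ih _ (s_mem h0 j).1 (s_mem h0 j).2) (le_of_eq ?_)
          refine JJ_congr fun x hx => ?_
          rw [Function.iterate_succ_apply, gm_br j hx.1 hx.2]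

noncomputable def PR (n d : ℕ) (x : ℝ) : ℝ := ∏ i ∈ Finset.range d, (pq (i * n + 1) x : ℝ)

noncomputable def EE (n d : ℕ) (Φ : ℝ) (x : ℝ) : ENNReal :=
  {x | Φ ≤ PR n d x}.indicator (fun _ => 1) x

lemma PR_succ (n d : ℕ) (x : ℝ) : PR n (d + 1) x = pq 1 x * PR n d (gaussMap^[n] x) := by
  unfold PR
  rw [Finset.prod_range_succ', mul_comm]
  simp only [zero_mul, zero_add]
  congr 1
  refine Finset.prod_congr rfl fun i _ => ?_
  unfold pq
  simp only [Nat.add_sub_cancel]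
  rw [← Function.iterate_add_apply]
  congr 5; ring

lemma EE_br (m d : ℕ) (Φ : ℝ) (j : ℕ) {y : ℝ} (h0 : 0 < y) (h1 : y < 1) :
    EE (m + 1) (d + 1) Φ (1 / ((j:ℝ) + 1 + y)) = EE (m + 1) d (Φ / (j + 1)) (gaussMap^[m] y) := by
  have hq : pq 1 (1 / ((j:ℝ) + 1 + y)) = j + 1 := by
    unfold pq; simp only [Nat.sub_self, Function.iterate_zero, id]
    rw [one_div_one_div, floor_br j h0.le h1]
  unfold EE
  simp only [Set.indicator, mem_ofPred_eq]
  rw [PR_succ, hq, Function.iterate_succ_apply, gm_br j h0 h1]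
  have hj : (0:ℝ) < j + 1 := by positivity
  simp only [div_le_iff₀' hj, Nat.cast_add, Nat.cast_one]

lemma JE_rec {t : ℝ} (ht : 0 ≤ t) (m d : ℕ) (Φ : ℝ) :
    JJ t (EE (m + 1) (d + 1) Φ) = ∑' j : ℕ, ENNReal.ofReal (pp t j) *
      JJ (1 / (j + 1 + t)) (fun y => EE (m + 1) d (Φ / (j + 1)) (gaussMap^[m] y)) := by
  rw [JJ_rec ht]
  congr 1; ext j; congr 1
  exact JJ_congr fun y hy => EE_br m d Φ j hy.1 hy.2

lemma JE_le_one {t : ℝ} (ht : 0 ≤ t) (n d : ℕ) (Φ : ℝ) : JJ t (EE n d Φ) ≤ 1 := by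
  rw [← JJ_one ht]
  refine JJ_mono fun x _ => ?_
  unfold EE
  exact Set.indicator_le_self' (by simp) x

lemma JE_one {t : ℝ} (ht : 0 ≤ t) (m : ℕ) {Φ : ℝ} (hΦ : 1 ≤ Φ) :
    JJ t (EE (m + 1) 1 Φ) = ENNReal.ofReal ((1 + t) / (⌈Φ⌉₊ + t)) := by
  have hc : 1 ≤ ⌈Φ⌉₊ := by
    have := Nat.le_ceil Φ
    exact_mod_cast hΦ.trans this
  obtain ⟨N, hN⟩ : ∃ N, ⌈Φ⌉₊ = N + 1 := ⟨⌈Φ⌉₊ - 1, by omega⟩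
  rw [JE_rec ht, ← Summable.sum_add_tsum_nat_add' (k := N) ENNReal.summable, Finset.sum_eq_zero, zero_add, hN]
  · push_cast
    rw [← tsum_pp ht N]
    congr 1; ext j
    have : Φ / (((j + N : ℕ):ℝ) + 1) ≤ 1 := by
      rw [div_le_one (by positivity)]
      refine (Nat.le_ceil Φ).trans ?_
      rw [hN]; push_cast; linarith [(j.cast_nonneg : (0:ℝ) ≤ j)]
    push_cast at this
    have h2 : ∀ y : ℝ, EE (m + 1) 0 (Φ / ((j:ℝ) + N + 1)) (gaussMap^[m] y) = 1 := by
      intro y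
      simp [EE, PR, this]
    push_cast
    simp_rw [h2]
    rw [JJ_one (by positivity), mul_one]
  · intro j hj
    have hj' : j + 1 < ⌈Φ⌉₊ := by simp at hj; omega
    have h1 := Nat.lt_ceil.1 hj'
    push_cast at h1
    have : ¬ Φ / ((j:ℝ) + 1) ≤ 1 := by
      rw [div_le_one (by positivity)]; linarith
    have h2 : ∀ y : ℝ, EE (m + 1) 0 (Φ / ((j:ℝ) + 1)) (gaussMap^[m] y) = 0 := by
      intro y
      simpa [EE, PR] using this
    simp_rw [h2]
    simp [JJ]

lemma upper (d : ℕ) : ∃ C : ℝ, 1 ≤ C ∧ ∀ (m : ℕ) (Φ : ℝ), 1 ≤ Φ → ∀ t : ℝ, 0 ≤ t → t ≤ 1 →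
    JJ t (EE (m + 1) (d + 1) Φ) ≤ ENNReal.ofReal (C * (1 + Real.log Φ) ^ d / Φ) := by
  induction d with
  | zero =>
    refine ⟨2, by norm_num, fun m Φ hΦ t h0 h1 => ?_⟩
    rw [zero_add, JE_one h0 m hΦ]
    apply ENNReal.ofReal_le_ofReal
    have := Nat.le_ceil Φ
    simp only [pow_zero, mul_one]
    gcongr <;> linarith
  | succ d ih =>
    obtain ⟨C, hC, h⟩ := ih
    refine ⟨2 * C + 2, by linarith, fun m Φ hΦ t h0 h1 => ?_⟩
    have hl : 0 ≤ Real.log Φ := Real.log_nonneg hΦ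
    have hΦ0 : 0 < Φ := by linarith
    set N := ⌊Φ⌋₊ with hN
    rw [JE_rec h0, ← Summable.sum_add_tsum_nat_add' (k := N) ENNReal.summable]
    have A : ∑ j ∈ Finset.range N, ENNReal.ofReal (pp t j) *
        JJ (1 / (j + 1 + t)) (fun y => EE (m + 1) (d + 1) (Φ / (j + 1)) (gaussMap^[m] y)) ≤
        ENNReal.ofReal (2 * C * (1 + Real.log Φ) ^ (d + 1) / Φ) := by
      calc _ ≤ ∑ j ∈ Finset.range N,
            ENNReal.ofReal (2 * C * (1 + Real.log Φ) ^ d / Φ * ((j:ℝ) + 1)⁻¹) := by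
            refine Finset.sum_le_sum fun j hj => ?_
            have hj0 : (0:ℝ) ≤ j := j.cast_nonneg
            have hjN : j + 1 ≤ N := by simp at hj; omega
            have hjΦ : (j:ℝ) + 1 ≤ Φ := by
              have : ((j + 1 : ℕ):ℝ) ≤ N := by exact_mod_cast hjN
              push_cast at this
              exact this.trans (Nat.floor_le hΦ0.le)
            have hq : 1 ≤ Φ / ((j:ℝ) + 1) := by rw [le_div_iff₀ (by positivity)]; linarith
            calc _ ≤ ENNReal.ofReal (pp t j) * ENNReal.ofReal
                  (C * (1 + Real.log (Φ / (j + 1))) ^ d / (Φ / (j + 1))) := by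
                  gcongr
                  exact JJ_iter_le (h m _ hq) m _ (s_mem h0 j).1 (s_mem h0 j).2
              _ ≤ _ := by
                rw [← ENNReal.ofReal_mul (pp_nonneg h0 j)]
                apply ENNReal.ofReal_le_ofReal
                have hlog : Real.log (Φ / (j + 1)) ≤ Real.log Φ :=
                  Real.log_le_log (by positivity) (div_le_self hΦ0.le (by linarith))
                have hlog0 : 0 ≤ Real.log (Φ / (j + 1)) := Real.log_nonneg hq
                have hpp : pp t j ≤ 2 / (((j:ℝ) + 1) * (j + 1)) := by
                  unfold pp
                  exact div_le_div₀ (by norm_num) (by linarith) (by positivity)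
                    (mul_le_mul (by linarith) (by linarith) (by positivity) (by positivity))
                calc _ ≤ 2 / (((j:ℝ) + 1) * (j + 1)) *
                      (C * (1 + Real.log Φ) ^ d / (Φ / (j + 1))) := by
                      gcongr
                  _ = _ := by field_simp
        _ ≤ _ := by
            rw [← ENNReal.ofReal_sum_of_nonneg (fun j _ => by positivity)]
            apply ENNReal.ofReal_le_ofReal
            rw [← Finset.mul_sum]
            have hh := harmonic_floor_le_one_add_log Φ hΦ
            have he : ((harmonic N : ℚ) : ℝ) = ∑ j ∈ Finset.range N, ((j:ℝ) + 1)⁻¹ := by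
              simp [harmonic]
            rw [← he]
            calc _ ≤ 2 * C * (1 + Real.log Φ) ^ d / Φ * (1 + Real.log Φ) := by gcongr
              _ = _ := by ring
    have B : ∑' j : ℕ, ENNReal.ofReal (pp t (j + N)) *
        JJ (1 / (((j + N : ℕ):ℝ) + 1 + t))
          (fun y => EE (m + 1) (d + 1) (Φ / (((j + N : ℕ):ℝ) + 1)) (gaussMap^[m] y)) ≤
        ENNReal.ofReal (2 * (1 + Real.log Φ) ^ (d + 1) / Φ) := by
      calc _ ≤ ∑' j : ℕ, ENNReal.ofReal (pp t (j + N)) := by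
            refine ENNReal.tsum_le_tsum fun j => ?_
            refine mul_le_of_le_one_right' ?_
            exact JJ_iter_le (fun t h0 _ => JE_le_one h0 _ _ _) m _ (s_mem h0 _).1 (s_mem h0 _).2
        _ = _ := tsum_pp h0 N
        _ ≤ _ := by
            apply ENNReal.ofReal_le_ofReal
            have hfl := Nat.lt_floor_add_one Φ
            have : (1:ℝ) ≤ (1 + Real.log Φ) ^ (d + 1) := one_le_pow₀ (by linarith)
            gcongr <;> linarith
    calc _ ≤ ENNReal.ofReal (2 * C * (1 + Real.log Φ) ^ (d + 1) / Φ) +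
          ENNReal.ofReal (2 * (1 + Real.log Φ) ^ (d + 1) / Φ) := add_le_add A B
      _ = _ := by
          rw [← ENNReal.ofReal_add (by positivity) (by positivity)]
          congr 1; ring

lemma lower (d : ℕ) : ∃ c : ℝ, 0 < c ∧ ∀ (m : ℕ) (Φ : ℝ), 1 ≤ Φ → ∀ t : ℝ, 0 ≤ t → t ≤ 1 →
    ENNReal.ofReal (c * (Real.log Φ) ^ d / Φ) ≤ JJ t (EE (m + 1) (d + 1) Φ) := by
  induction d with
  | zero =>
    refine ⟨1 / 2, by norm_num, fun m Φ hΦ t h0 h1 => ?_⟩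
    rw [zero_add, JE_one h0 m hΦ]
    apply ENNReal.ofReal_le_ofReal
    have := Nat.ceil_lt_add_one (by linarith : 0 ≤ Φ)
    simp only [pow_zero, mul_one]
    rw [div_le_div_iff₀ (by linarith) (by positivity)]
    nlinarith
  | succ d ih =>
    obtain ⟨c, hc, h⟩ := ih
    refine ⟨c / 6 * (1 / 2) ^ (d + 1), by positivity, fun m Φ hΦ t h0 h1 => ?_⟩
    have hl : 0 ≤ Real.log Φ := Real.log_nonneg hΦ
    have hΦ0 : 0 < Φ := by linarith
    have hs1 : 1 ≤ √Φ := by rw [Real.one_le_sqrt]; exact hΦ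
    have hss : √Φ * √Φ = Φ := Real.mul_self_sqrt hΦ0.le
    have hls : Real.log (√Φ) = 1 / 2 * Real.log Φ := by rw [Real.log_sqrt hΦ0.le]; ring
    have hls0 : 0 ≤ Real.log (√Φ) := Real.log_nonneg hs1
    set N := ⌊√Φ⌋₊ with hN
    rw [JE_rec h0]
    refine le_trans ?_ (ENNReal.sum_le_tsum (Finset.range N))
    calc _ ≤ ∑ j ∈ Finset.range N,
          ENNReal.ofReal (c / 6 * (1 / 2 * Real.log Φ) ^ d / Φ * ((j:ℝ) + 1)⁻¹) := by
          rw [← ENNReal.ofReal_sum_of_nonneg (fun j _ => by positivity)]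
          apply ENNReal.ofReal_le_ofReal
          rw [← Finset.mul_sum]
          have hh := log_le_harmonic_floor (√Φ) (by positivity)
          have he : ((harmonic N : ℚ) : ℝ) = ∑ j ∈ Finset.range N, ((j:ℝ) + 1)⁻¹ := by
            simp [harmonic]
          rw [← he]
          calc _ = c / 6 * (1 / 2 * Real.log Φ) ^ d / Φ * (1 / 2 * Real.log Φ) := by
                rw [mul_pow]; ring
            _ ≤ _ := by
                rw [← hls]; gcongr
      _ ≤ _ := by
          refine Finset.sum_le_sum fun j hj => ?_
          have hj0 : (0:ℝ) ≤ j := j.cast_nonneg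
          have hjN : j + 1 ≤ N := by simp at hj; omega
          have hjΦ : (j:ℝ) + 1 ≤ √Φ := by
            have : ((j + 1 : ℕ):ℝ) ≤ N := by exact_mod_cast hjN
            push_cast at this
            exact this.trans (Nat.floor_le (by positivity))
          have hq' : √Φ ≤ Φ / ((j:ℝ) + 1) := by
            rw [le_div_iff₀ (by positivity)]; nlinarith
          have hq := hs1.trans hq'
          calc _ ≤ ENNReal.ofReal (pp t j) * ENNReal.ofReal
                  (c * (Real.log (Φ / (j + 1))) ^ d / (Φ / (j + 1))) := by
                rw [← ENNReal.ofReal_mul (pp_nonneg h0 j)]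
                apply ENNReal.ofReal_le_ofReal
                have hlog : 1 / 2 * Real.log Φ ≤ Real.log (Φ / (j + 1)) := by
                  rw [← hls]
                  exact Real.log_le_log (by positivity) hq'
                have hppn := pp_nonneg h0 j
                have hpp : 1 / 6 / (((j:ℝ) + 1) * (j + 1)) ≤ pp t j := by
                  unfold pp
                  rw [div_div, div_le_div_iff₀ (by positivity) (by positivity)]
                  have : (j + 1 + t) * (j + 2 + t) ≤ ((j:ℝ) + 2) * (j + 3) :=
                    mul_le_mul (by linarith) (by linarith) (by positivity) (by positivity)
                  nlinarith [mul_nonneg h0 (mul_nonneg hj0 hj0), mul_nonneg h0 hj0]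
                calc _ = 1 / 6 / (((j:ℝ) + 1) * (j + 1)) *
                      (c * (1 / 2 * Real.log Φ) ^ d / (Φ / (j + 1))) := by
                      field_simp
                  _ ≤ _ := by gcongr
            _ ≤ _ := by
                gcongr
                exact le_JJ_iter (h m _ hq) m _ (s_mem h0 j).1 (s_mem h0 j).2

lemma measurable_gaussMap : Measurable gaussMap := by
  unfold gaussMap
  refine Measurable.ite (measurableSet_eq) measurable_const ?_
  fun_prop

lemma measurable_PR (n d : ℕ) : Measurable (PR n d) := by
  unfold PR
  refine Finset.measurable_fun_prod _ fun i _ => ?_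
  unfold pq
  have h : Measurable (gaussMap^[i * n + 1 - 1]) := measurable_gaussMap.iterate _
  have h2 : Measurable fun x => ⌊1 / gaussMap^[i * n + 1 - 1] x⌋₊ :=
    Nat.measurable_floor.comp (h.const_div 1)
  exact measurable_from_nat.comp h2

lemma vol_eq (n d : ℕ) (Φ : ℝ) :
    volume {x : ℝ | x ∈ Set.Ico (0 : ℝ) 1 ∧ Irrational x ∧
            Φ ≤ ∏ i ∈ Finset.range d, (pq (i * n + 1) x : ℝ)} = JJ 0 (EE n d Φ) := by
  have hm : MeasurableSet {x | Φ ≤ PR n d x} := measurableSet_le measurable_const (measurable_PR n d)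
  have : JJ 0 (EE n d Φ) = volume ({x | Φ ≤ PR n d x} ∩ Ioo 0 1) := by
    unfold JJ EE
    simp only [add_zero, zero_mul, one_pow, div_one, ENNReal.ofReal_one, one_mul]
    rw [lintegral_indicator hm, setLIntegral_one, Measure.restrict_apply hm]
  rw [this]
  apply measure_congr
  have hirr : ∀ᵐ x : ℝ, Irrational x := by
    have : (Set.range ((↑) : ℚ → ℝ)).Countable := countable_range _
    exact this.ae_notMem volume
  filter_upwards [hirr] with x hx
  apply propext
  change (x ∈ Ico (0:ℝ) 1 ∧ Irrational x ∧ Φ ≤ PR n d x) ↔ (Φ ≤ PR n d x ∧ x ∈ Ioo (0:ℝ) 1)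
  have h0 : x ≠ 0 := hx.ne_zero
  constructor
  · rintro ⟨h1, _, h3⟩
    exact ⟨h3, lt_of_le_of_ne h1.1 h0.symm, h1.2⟩
  · rintro ⟨h1, h2⟩
    exact ⟨⟨h2.1.le, h2.2⟩, hx, h1⟩

/-- There are constants `0 < c₁ ≤ c₂` depending only on `d` such that for every
`Φ : ℕ → [2,∞)` and every `n ≥ 1`, the Lebesgue measure of
`{x ∈ [0,1) irrational : a_1(x) a_{n+1}(x) ⋯ a_{(d-1)n+1}(x) ≥ Φ(n)}`
lies between `c₁ (log Φ(n))^{d-1}/Φ(n)` and `c₂ (log Φ(n))^{d-1}/Φ(n)`. -/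
theorem measure_prod_pq_arith_progression (d : ℕ) (hd : 1 ≤ d) :
    ∃ c₁ c₂ : ℝ, 0 < c₁ ∧ c₁ ≤ c₂ ∧
      ∀ Φ : ℕ → ℝ, (∀ n, 2 ≤ Φ n) → ∀ n, 1 ≤ n →
        ENNReal.ofReal (c₁ * (Real.log (Φ n)) ^ (d - 1) / Φ n) ≤
          volume {x : ℝ | x ∈ Set.Ico (0 : ℝ) 1 ∧ Irrational x ∧
            Φ n ≤ ∏ i ∈ Finset.range d, (pq (i * n + 1) x : ℝ)} ∧
        volume {x : ℝ | x ∈ Set.Ico (0 : ℝ) 1 ∧ Irrational x ∧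
            Φ n ≤ ∏ i ∈ Finset.range d, (pq (i * n + 1) x : ℝ)} ≤
          ENNReal.ofReal (c₂ * (Real.log (Φ n)) ^ (d - 1) / Φ n) := by
  obtain ⟨d, rfl⟩ : ∃ e, d = e + 1 := ⟨d - 1, by omega⟩
  obtain ⟨C, hC, hU⟩ := upper d
  obtain ⟨c, hc, hL⟩ := lower d
  refine ⟨c, max c (C * 3 ^ d), hc, le_max_left _ _, fun Φ hΦ n hn => ?_⟩
  obtain ⟨m, rfl⟩ : ∃ m, n = m + 1 := ⟨n - 1, by omega⟩
  rw [vol_eq, Nat.add_sub_cancel]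
  have h2 := hΦ (m + 1)
  refine ⟨hL m _ (by linarith) 0 le_rfl zero_le_one, ?_⟩
  refine (hU m _ (by linarith) 0 le_rfl zero_le_one).trans ?_
  apply ENNReal.ofReal_le_ofReal
  have hl2 : (0.5:ℝ) ≤ Real.log 2 := by linarith [Real.log_two_gt_d9]
  have hl : Real.log 2 ≤ Real.log (Φ (m + 1)) := Real.log_le_log (by norm_num) h2
  have hlp : 0 ≤ Real.log (Φ (m + 1)) := by linarith
  have : (1 + Real.log (Φ (m + 1))) ^ d ≤ 3 ^ d * Real.log (Φ (m + 1)) ^ d := by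
    rw [← mul_pow]
    gcongr
    linarith
  have hp : 0 < Φ (m + 1) := by linarith
  calc _ ≤ C * (3 ^ d * Real.log (Φ (m + 1)) ^ d) / Φ (m + 1) := by gcongr
    _ = (C * 3 ^ d) * Real.log (Φ (m + 1)) ^ d / Φ (m + 1) := by ring
    _ ≤ _ := by
      gcongr
      exact le_max_right _ _
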